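/- Let V be any partial function from binary strings to binary strings, and let n, k, R be natural numbers. Then the number of binary strings h of length n such that at least 2^(n·k)/100 of the k×n matrices A over ZMod 2 satisfy C_V(enc(A)·h) ≤ n·k + k − R is at most 100·2^(k−R+1). -/

import Mathlib

/-- Plain Kolmogorov complexity of `x` under decompressor `V`, in `ℕ∞` (`⊤` if no description). -/
noncomputable def plainC (V : List Bool →. List Bool) (x : List Bool) : ℕ∞ :=
  sInf {m : ℕ∞ | ∃ d : List Bool, x ∈ V d ∧ (d.length : ℕ∞) = m}

/-- Conditional Kolmogorov complexity of `x` given `y` under conditional decompressor `V`. -/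
noncomputable def condC (V : List Bool × List Bool →. List Bool) (x y : List Bool) : ℕ∞ :=
  sInf {m : ℕ∞ | ∃ d : List Bool, x ∈ V (d, y) ∧ (d.length : ℕ∞) = m}

/-- `V` is a universal plain decompressor. -/
def PlainUniversal (V : List Bool →. List Bool) : Prop :=
  Partrec V ∧ ∀ W : List Bool →. List Bool, Partrec W →
    ∃ c : ℕ, ∀ x : List Bool, plainC V x ≤ plainC W x + c

/-- `V` is a universal conditional decompressor. -/
def CondUniversal (V : List Bool × List Bool →. List Bool) : Prop :=
  Partrec V ∧ ∀ W : List Bool × List Bool →. List Bool, Partrec W →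
    ∃ c : ℕ, ∀ x y : List Bool, condC V x y ≤ condC W x y + c

/-- Row-major encoding of a `k × n` binary matrix as a binary string (length `n·k`). -/
def encM {k n : ℕ} (A : Matrix (Fin k) (Fin n) (ZMod 2)) : List Bool :=
  (List.finRange k).flatMap fun i => (List.finRange n).map fun j => decide (A i j = 1)

/-- The vector in `(ZMod 2)^n` associated to a binary string (of length `n`). -/
def vecOf (n : ℕ) (s : List Bool) : Fin n → ZMod 2 :=
  fun i => if s.getD i false then 1 else 0

/-- The binary string (of length `k`) associated to a vector in `(ZMod 2)^k`. -/
def strOf {k : ℕ} (v : Fin k → ZMod 2) : List Bool :=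
  List.ofFn fun i => decide (v i = 1)

/-- The partial recursive code associated to a binary string, via the canonical
computable bijection between `List Bool` and `Nat.Partrec.Code`. -/
def codeOf (x : List Bool) : Nat.Partrec.Code :=
  Denumerable.ofNat Nat.Partrec.Code (Encodable.encode x)

/-- The halting set: strings whose associated program halts on the empty input. -/
def Halts (x : List Bool) : Prop := ((codeOf x).eval 0).Dom


theorem exists_description_of_plainC_le {V : List Bool →. List Bool} {x : List Bool} {N : ℕ}
    (h : plainC V x ≤ (N : ℕ∞)) : ∃ d : List Bool, x ∈ V d ∧ d.length ≤ N := by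
  have hlt : plainC V x < ((N + 1 : ℕ) : ℕ∞) :=
    lt_of_le_of_lt h (by exact_mod_cast Nat.lt_succ_self N)
  obtain ⟨m, ⟨d, hd, rfl⟩, hm⟩ := sInf_lt_iff.mp hlt
  exact ⟨d, hd, Nat.lt_succ_iff.mp (by exact_mod_cast hm)⟩

theorem List.eq_of_flatMap_eq_of_length_eq {α β : Type*} {f g : α → List β} {l : List α}
    (hlen : ∀ i ∈ l, (f i).length = (g i).length) (h : l.flatMap f = l.flatMap g) :
    ∀ i ∈ l, f i = g i := by
  induction l with
  | nil => simp
  | cons a l ih =>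
    rw [List.flatMap_cons, List.flatMap_cons] at h
    obtain ⟨h₁, h₂⟩ := List.append_inj h (hlen a (by simp))
    have := ih (fun i hi => hlen i (by simp [hi])) h₂
    simpa [h₁] using this

theorem encM_injective {k n : ℕ} :
    Function.Injective (encM : Matrix (Fin k) (Fin n) (ZMod 2) → List Bool) := by
  intro A B h
  ext i j
  have hrow := List.eq_of_flatMap_eq_of_length_eq (by simp) h i (List.mem_finRange i)
  have hentry : decide (A i j = 1) = decide (B i j = 1) :=
    List.map_inj_left.mp hrow j (List.mem_finRange j)
  generalize A i j = a at hentry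
  generalize B i j = b at hentry
  revert a b
  decide

/-- Strings of length at most `N`, grouped by length. -/
abbrev ShortString (N : ℕ) : Type := Σ i : Fin (N + 1), List.Vector Bool i

theorem card_shortString_le (N : ℕ) : Fintype.card (ShortString N) ≤ 2 ^ (N + 1) := by
  rw [Fintype.card_sigma]
  simp only [card_vector, Fintype.card_bool]
  rw [Fin.sum_univ_eq_sum_range (fun i => 2 ^ i)]
  exact (Nat.geomSum_lt le_rfl (by simp)).le

/-- Counting argument in Lemma 3: at most `100 · 2^(k-R+1)` strings `h` of length `n`
are such that at least a `1/100` fraction of the `k × n` binary matrices `A` satisfy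
`C_V(enc(A)·h) ≤ n·k + k - R`. -/
theorem card_strings_often_compressible (V : List Bool →. List Bool) (n k R : ℕ) :
    Nat.card {h : List Bool // h.length = n ∧
        2 ^ (n * k) ≤ 100 * Nat.card {A : Matrix (Fin k) (Fin n) (ZMod 2) //
          plainC V (encM A ++ h) ≤ ((n * k + k - R : ℕ) : ℕ∞)}} ≤
      100 * 2 ^ (k - R + 1) := by
  set N := n * k + k - R with hN
  set S := {h : List Bool // h.length = n ∧
    2 ^ (n * k) ≤ 100 * Nat.card {A : Matrix (Fin k) (Fin n) (ZMod 2) //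
      plainC V (encM A ++ h) ≤ (N : ℕ∞)}}
  let T : S → Type := fun h =>
    {A : Matrix (Fin k) (Fin n) (ZMod 2) // plainC V (encM A ++ h.1) ≤ (N : ℕ∞)}
  have : Finite S :=
    Finite.of_injective (β := List.Vector Bool n) (fun h => ⟨h.1, h.2.1⟩) fun a b hab =>
      Subtype.ext (Subtype.mk.inj hab)
  have := Fintype.ofFinite S
  have (h : S) : Finite (T h) := by dsimp only [T]; infer_instance
  choose d hd hdlen using fun p : Σ h : S, T h => exists_description_of_plainC_le p.2.2
  let F : (Σ h : S, T h) → ShortString N := fun p =>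
    ⟨⟨(d p).length, Nat.lt_succ_iff.mpr (hdlen p)⟩, ⟨d p, rfl⟩⟩
  have hF : Function.Injective F := by
    intro p q hpq
    have hdpq : d p = d q := congrArg (fun s : ShortString N => s.2.1) hpq
    have heq := Part.mem_unique (hd p) (hdpq ▸ hd q)
    obtain ⟨⟨h, hh⟩, A, hA⟩ := p
    obtain ⟨⟨h', hh'⟩, B, hB⟩ := q
    obtain ⟨hAB, rfl⟩ := List.append_inj' heq (hh.1.trans hh'.1.symm)
    obtain rfl := encM_injective hAB
    rfl
  have hpairs : ∑ h : S, Nat.card (T h) ≤ 2 ^ (N + 1) := by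
    rw [← Nat.card_sigma]
    exact (Nat.card_le_card_of_injective F hF).trans
      (Nat.card_eq_fintype_card.trans_le (card_shortString_le N))
  have hsum : Nat.card S * 2 ^ (n * k) ≤ 100 * ∑ h : S, Nat.card (T h) := by
    rw [Finset.mul_sum, Nat.card_eq_fintype_card, ← smul_eq_mul, ← Finset.card_univ]
    exact Finset.card_nsmul_le_sum _ _ _ fun h _ => h.2.2
  refine Nat.le_of_mul_le_mul_right ?_ (Nat.two_pow_pos (n * k))
  calc Nat.card S * 2 ^ (n * k) ≤ 100 * 2 ^ (N + 1) := hsum.trans (Nat.mul_le_mul_left _ hpairs)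
    _ ≤ 100 * 2 ^ (k - R + 1 + n * k) :=
      Nat.mul_le_mul_left _ (Nat.pow_le_pow_right two_pos (by omega))
    _ = 100 * 2 ^ (k - R + 1) * 2 ^ (n * k) := by rw [pow_add, mul_assoc]
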